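/- (Lemma 2) Fix a subset S ⊆ {1,…,d}, an index i ∉ S, a value x_S, and a value z of Z with P(X_S = x_S, Z = z) > 0. Then the incremental loss improvement of the Bayes classifier that also conditions on the prior information is an unbiased estimator of the corresponding conditional mutual information: E[Δ(x_S, X_i, z, Y) | X_S = x_S, Z = z] = I(Y; X_i | X_S = x_S, Z = z). -/

import Mathlib

open MeasureTheory ProbabilityTheory
open scoped ENNReal NNReal

noncomputable section

variable {Ω : Type}

/-- Conditional probability of `B` given `A`, as a real number. -/
def cpr [MeasureSpace Ω] (A B : Set Ω) : ℝ :=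
  (((ℙ : Measure Ω)[|A]) B).toReal

/-- Conditional expectation of `g` given the event `A`. -/
def cexp [MeasureSpace Ω] (A : Set Ω) (g : Ω → ℝ) : ℝ :=
  ∫ ω, g ω ∂((ℙ : Measure Ω)[|A])

/-- Conditional variance of `g` given the event `A`. -/
def cvar [MeasureSpace Ω] (A : Set Ω) (g : Ω → ℝ) : ℝ :=
  variance g ((ℙ : Measure Ω)[|A])

/-- Conditional pmf of `Y` given the event `A`. -/
def cpmf {𝒴 : Type} [MeasureSpace Ω] (Y : Ω → 𝒴) (A : Set Ω) (y : 𝒴) : ℝ :=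
  cpr A {ω | Y ω = y}

/-- Cross-entropy loss `ℓ(q, y) = -log q(y)`. -/
def xent {𝒴 : Type} (q : 𝒴 → ℝ) (y : 𝒴) : ℝ := -Real.log (q y)

/-- `q` is a probability mass function on the finite type `𝒴`. -/
def IsPMF {𝒴 : Type} [Fintype 𝒴] (q : 𝒴 → ℝ) : Prop :=
  (∀ y, 0 ≤ q y) ∧ ∑ y, q y = 1

/-- Conditional entropy `H(Y | A)` of the finitely-valued `Y` on the event `A`. -/
def entropyOn {𝒴 : Type} [MeasureSpace Ω] [Fintype 𝒴] (Y : Ω → 𝒴) (A : Set Ω) : ℝ :=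
  -∑ y, cpmf Y A y * Real.log (cpmf Y A y)

/-- Kullback–Leibler divergence between pmfs on a finite type. -/
def klDivFin {𝒴 : Type} [Fintype 𝒴] (p q : 𝒴 → ℝ) : ℝ :=
  ∑ y, p y * Real.log (p y / q y)

/-- Conditional mutual information `I(Y; Xi | A)` on the event `A`. -/
def cmi {𝒴 𝒳i : Type} [MeasureSpace Ω] [Fintype 𝒴] [Fintype 𝒳i]
    (Y : Ω → 𝒴) (Xi : Ω → 𝒳i) (A : Set Ω) : ℝ :=
  entropyOn Y A - ∑ xi, cpr A {ω | Xi ω = xi} * entropyOn Y (A ∩ {ω | Xi ω = xi})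

/-- The event `X_S = x_S`. -/
def evS {d : ℕ} {𝒳 : Fin d → Type} (X : ∀ i, Ω → 𝒳 i) (S : Finset (Fin d))
    (x : ∀ i, 𝒳 i) : Set Ω :=
  {ω | ∀ i ∈ S, X i ω = x i}

/-- `-log t` valued in `[0, ∞]`, with the convention `-log 0 = +∞`. -/
def negLog (t : ℝ) : ℝ≥0∞ := if t = 0 then ⊤ else ENNReal.ofReal (-Real.log t)

/-- The expectation of a function of a finitely-valued random variable is a finite sum. -/
lemma cexp_comp_eq_sum [MeasureSpace Ω] [IsFiniteMeasure (ℙ : Measure Ω)]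
    {α : Type} [Fintype α] [MeasurableSpace α] [MeasurableSingletonClass α]
    (W : Ω → α) (hW : Measurable W) (A : Set Ω) (f : α → ℝ) :
    cexp A (fun ω => f (W ω)) = ∑ w, cpr A {ω | W ω = w} * f w := by
  have hf : Measurable f := measurable_of_finite f
  rw [cexp, ← integral_map (f := f) hW.aemeasurable hf.aestronglyMeasurable,
    integral_fintype .of_finite]
  refine Finset.sum_congr rfl fun w _ => ?_
  rw [measureReal_def, Measure.map_apply hW (measurableSet_singleton w), smul_eq_mul]
  rfl

/-- The chain rule for conditional probabilities. -/
lemma cpr_inter [MeasureSpace Ω] [IsFiniteMeasure (ℙ : Measure Ω)]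
    {A B : Set Ω} (hA : MeasurableSet A) (hB : MeasurableSet B) (C : Set Ω) :
    cpr A (B ∩ C) = cpr A B * cpr (A ∩ B) C := by
  rw [cpr, cpr, cpr, ← cond_cond_eq_cond_inter hA hB, mul_comm, ← ENNReal.toReal_mul,
    cond_mul_eq_inter hB]

lemma cexp_xent_cpmf [MeasureSpace Ω] [IsFiniteMeasure (ℙ : Measure Ω)]
    {𝒴 : Type} [Fintype 𝒴] [MeasurableSpace 𝒴] [MeasurableSingletonClass 𝒴]
    (Y : Ω → 𝒴) (hY : Measurable Y) (A : Set Ω) :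
    cexp A (fun ω => xent (cpmf Y A) (Y ω)) = entropyOn Y A := by
  rw [cexp_comp_eq_sum Y hY A (xent (cpmf Y A)), entropyOn, ← Finset.sum_neg_distrib]
  exact Finset.sum_congr rfl fun y _ => mul_neg _ _

lemma cexp_xent_cpmf_inter [MeasureSpace Ω] [IsFiniteMeasure (ℙ : Measure Ω)]
    {𝒴 : Type} [Fintype 𝒴] [MeasurableSpace 𝒴] [MeasurableSingletonClass 𝒴]
    {α : Type} [Fintype α] [MeasurableSpace α] [MeasurableSingletonClass α]
    (Y : Ω → 𝒴) (hY : Measurable Y) (W : Ω → α) (hW : Measurable W)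
    {A : Set Ω} (hA : MeasurableSet A) :
    cexp A (fun ω => xent (cpmf Y (A ∩ {ω' | W ω' = W ω})) (Y ω))
      = ∑ w, cpr A {ω | W ω = w} * entropyOn Y (A ∩ {ω | W ω = w}) := by
  rw [cexp_comp_eq_sum (fun ω => (W ω, Y ω)) (hW.prodMk hY) A
    (fun p => xent (cpmf Y (A ∩ {ω' | W ω' = p.1})) p.2), Fintype.sum_prod_type]
  refine Finset.sum_congr rfl fun w _ => ?_
  rw [entropyOn, ← Finset.sum_neg_distrib, Finset.mul_sum]
  refine Finset.sum_congr rfl fun y _ => ?_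
  have hset : {ω | (W ω, Y ω) = (w, y)} = {ω | W ω = w} ∩ {ω | Y ω = y} := by
    ext ω
    simp
  rw [hset, cpr_inter (B := {ω | W ω = w}) hA (hW (measurableSet_singleton w)), xent, cpmf]
  ring

lemma integrable_comp_of_finite [MeasureSpace Ω] [IsFiniteMeasure (ℙ : Measure Ω)]
    {α : Type} [Fintype α] [MeasurableSpace α] [MeasurableSingletonClass α]
    (W : Ω → α) (hW : Measurable W) (A : Set Ω) (f : α → ℝ) :
    Integrable (fun ω => f (W ω)) ((ℙ : Measure Ω)[|A]) :=
  (Integrable.of_finite (μ := ((ℙ : Measure Ω)[|A]).map W)).comp_measurable hW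

lemma measurableSet_evS [MeasurableSpace Ω] {d : ℕ} {𝒳 : Fin d → Type}
    [∀ i, MeasurableSpace (𝒳 i)] [∀ i, MeasurableSingletonClass (𝒳 i)]
    (X : ∀ i, Ω → 𝒳 i) (hX : ∀ i, Measurable (X i)) (S : Finset (Fin d)) (x : ∀ i, 𝒳 i) :
    MeasurableSet (evS X S x) := by
  have h : evS X S x = ⋂ i ∈ S, X i ⁻¹' {x i} := by
    ext ω
    simp [evS]
  rw [h]
  exact Finset.measurableSet_biInter S fun i _ => hX i (measurableSet_singleton (x i))

/-- **Lemma 2.** With prior information `Z`, the incremental loss improvement of the Bayes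
classifier that also conditions on `Z = z` is an unbiased estimator of the corresponding
conditional mutual information:
`E[Δ(x_S, X_i, z, Y) | X_S = x_S, Z = z] = I(Y; X_i | X_S = x_S, Z = z)`. -/
theorem lemma2_unbiased_cmi_prior
    [MeasureSpace Ω] [IsProbabilityMeasure (ℙ : Measure Ω)]
    {𝒴 : Type} [Fintype 𝒴] [MeasurableSpace 𝒴] [MeasurableSingletonClass 𝒴]
    {𝒵 : Type} [Fintype 𝒵] [MeasurableSpace 𝒵] [MeasurableSingletonClass 𝒵]
    {d : ℕ} {𝒳 : Fin d → Type} [∀ i, Fintype (𝒳 i)]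
    [∀ i, MeasurableSpace (𝒳 i)] [∀ i, MeasurableSingletonClass (𝒳 i)]
    (X : ∀ i, Ω → 𝒳 i) (Y : Ω → 𝒴) (Z : Ω → 𝒵)
    (hX : ∀ i, Measurable (X i)) (hY : Measurable Y) (hZ : Measurable Z)
    (S : Finset (Fin d)) (i : Fin d) (hi : i ∉ S)
    (x : ∀ j, 𝒳 j) (z : 𝒵)
    (hpos : 0 < (ℙ : Measure Ω) (evS X S x ∩ {ω | Z ω = z})) :
    cexp (evS X S x ∩ {ω | Z ω = z})
      (fun ω => xent (cpmf Y (evS X S x ∩ {ω' | Z ω' = z})) (Y ω)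
        - xent (cpmf Y (evS X S x ∩ {ω' | Z ω' = z} ∩ {ω' | X i ω' = X i ω})) (Y ω))
      = cmi Y (X i) (evS X S x ∩ {ω | Z ω = z}) := by
  have hA : MeasurableSet (evS X S x ∩ {ω | Z ω = z}) :=
    (measurableSet_evS X hX S x).inter (hZ (measurableSet_singleton z))
  generalize evS X S x ∩ {ω | Z ω = z} = A at *
  rw [cmi, ← cexp_xent_cpmf Y hY A, ← cexp_xent_cpmf_inter Y hY (X i) (hX i) hA]
  exact integral_sub
    (integrable_comp_of_finite Y hY A (xent (cpmf Y A)))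
    (integrable_comp_of_finite (fun ω => (X i ω, Y ω)) ((hX i).prodMk hY) A
      (fun p => xent (cpmf Y (A ∩ {ω' | X i ω' = p.1})) p.2))
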